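/- For all d, p, r ∈ ℕ there exists an increasing function h : ℕ → ℕ such that for every m ∈ ℕ with m ≥ 1, the number of equivalence classes of the relation ≡^MSO_m restricted to the class TM(r,p,d) is at most tower(d+1, h(d)·m²·(1 + ⌈log₂ r⌉ + ⌈log₂ p⌉)²). -/

import Mathlib

open Cardinal

/-- The tower function: `tower 0 n = n`, `tower (d+1) n = 2 ^ tower d n`. -/
def tower : ℕ → ℕ → ℕ
  | 0, n => n
  | d + 1, n => 2 ^ tower d n

/-- MSO formulas over the vocabulary consisting of one binary relation symbol `E`
and unary relation symbols indexed by `ι`.  First-order variables and set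
variables are both indexed by `ℕ`. -/
inductive MSOForm (ι : Type u) : Type u
  | fal : MSOForm ι
  | eq : ℕ → ℕ → MSOForm ι
  | edge : ℕ → ℕ → MSOForm ι
  | pred : ι → ℕ → MSOForm ι
  | mem : ℕ → ℕ → MSOForm ι
  | imp : MSOForm ι → MSOForm ι → MSOForm ι
  | exFO : ℕ → MSOForm ι → MSOForm ι
  | exSO : ℕ → MSOForm ι → MSOForm ι

namespace MSOForm

variable {ι : Type u}

/-- Quantifier rank: the maximum nesting depth of (first- and second-order) quantifiers. -/
def qr : MSOForm ι → ℕ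
  | fal => 0
  | eq _ _ => 0
  | edge _ _ => 0
  | pred _ _ => 0
  | mem _ _ => 0
  | imp φ ψ => max φ.qr ψ.qr
  | exFO _ φ => φ.qr + 1
  | exSO _ φ => φ.qr + 1

/-- Free first-order variables. -/
def freeFO : MSOForm ι → Finset ℕ
  | fal => ∅
  | eq i j => {i, j}
  | edge i j => {i, j}
  | pred _ i => {i}
  | mem i _ => {i}
  | imp φ ψ => φ.freeFO ∪ ψ.freeFO
  | exFO n φ => φ.freeFO.erase n
  | exSO _ φ => φ.freeFO

/-- Free set variables. -/
def freeSO : MSOForm ι → Finset ℕ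
  | fal => ∅
  | eq _ _ => ∅
  | edge _ _ => ∅
  | pred _ _ => ∅
  | mem _ X => {X}
  | imp φ ψ => φ.freeSO ∪ ψ.freeSO
  | exFO _ φ => φ.freeSO
  | exSO X φ => φ.freeSO.erase X

/-- A sentence is a formula with no free variables of either kind. -/
def IsSentence (φ : MSOForm ι) : Prop := φ.freeFO = ∅ ∧ φ.freeSO = ∅

/-- First-order formulas: no set quantification and no set membership. -/
def IsFO : MSOForm ι → Prop
  | fal => True
  | eq _ _ => True
  | edge _ _ => True
  | pred _ _ => True
  | mem _ _ => False
  | imp φ ψ => φ.IsFO ∧ ψ.IsFO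
  | exFO _ φ => φ.IsFO
  | exSO _ _ => False

/-- Formulas that do not mention the binary relation symbol `E`
(i.e. formulas over a purely monadic vocabulary). -/
def NoEdge : MSOForm ι → Prop
  | fal => True
  | eq _ _ => True
  | edge _ _ => False
  | pred _ _ => True
  | mem _ _ => True
  | imp φ ψ => φ.NoEdge ∧ ψ.NoEdge
  | exFO _ φ => φ.NoEdge
  | exSO _ φ => φ.NoEdge

end MSOForm

/-- A structure over the vocabulary with one binary relation `E` and `ι`-indexed
unary predicates: a universe, a binary relation and unary relations. -/
structure MStr (ι : Type u) where
  V : Type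
  E : V → V → Prop
  P : ι → V → Prop

namespace MStr

/-- Satisfaction of an MSO formula under first-order and set variable assignments. -/
def Realize {ι : Type u} (M : MStr ι) : MSOForm ι → (ℕ → M.V) → (ℕ → Set M.V) → Prop
  | .fal, _, _ => False
  | .eq i j, v, _ => v i = v j
  | .edge i j, v, _ => M.E (v i) (v j)
  | .pred a i, v, _ => M.P a (v i)
  | .mem i X, v, s => v i ∈ s X
  | .imp φ ψ, v, s => Realize M φ v s → Realize M ψ v s
  | .exFO n φ, v, s => ∃ x : M.V, Realize M φ (Function.update v n x) s
  | .exSO X φ, v, s => ∃ A : Set M.V, Realize M φ v (Function.update s X A)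

/-- A structure satisfies a sentence. -/
def Sat {ι : Type u} (M : MStr ι) (φ : MSOForm ι) : Prop :=
  ∀ (v : ℕ → M.V) (s : ℕ → Set M.V), M.Realize φ v s

/-- `M ≡^MSO_m N` : `M` and `N` agree on all MSO sentences of quantifier rank at most `m`. -/
def MSOEquiv {ι : Type u} (m : ℕ) (M N : MStr ι) : Prop :=
  ∀ φ : MSOForm ι, φ.IsSentence → φ.qr ≤ m → (M.Sat φ ↔ N.Sat φ)

/-- `M` and `N` agree on all MSO sentences. -/
def MSOEq {ι : Type u} (M N : MStr ι) : Prop :=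
  ∀ φ : MSOForm ι, φ.IsSentence → (M.Sat φ ↔ N.Sat φ)

/-- `M ≡^FO_q N` over a purely monadic vocabulary: `M` and `N` agree on all
first-order sentences (not mentioning `E`) of quantifier rank at most `q`. -/
def FOEquiv {ι : Type u} (q : ℕ) (M N : MStr ι) : Prop :=
  ∀ φ : MSOForm ι, φ.IsFO → φ.NoEdge → φ.IsSentence → φ.qr ≤ q → (M.Sat φ ↔ N.Sat φ)

end MStr

/-- A (finite or infinite) `p`-labeled graph: a simple undirected loop-free graph
each of whose vertices carries exactly one label from `Fin p`. -/
structure PGraph (p : ℕ) where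
  V : Type
  adj : V → V → Prop
  symm : ∀ u v, adj u v → adj v u
  irrefl : ∀ v, ¬ adj v v
  label : V → Fin p

namespace PGraph

variable {p : ℕ}

/-- A `p`-labeled graph as a structure over the vocabulary `{E, P_1, …, P_p}`. -/
def toStr (G : PGraph p) : MStr (Fin p) :=
  ⟨G.V, G.adj, fun j v => G.label v = j⟩

/-- The induced labeled subgraph on a set of vertices (with the inherited labels). -/
def induce (G : PGraph p) (s : Set G.V) : PGraph p where
  V := ↥s
  adj a b := G.adj a.1 b.1
  symm := fun _ _ h => G.symm _ _ h
  irrefl := fun _ h => G.irrefl _ h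
  label := fun a => G.label a.1

/-- `G` is an induced labeled subgraph of `H` (up to isomorphism):
there is an injection of `G` into `H` preserving adjacency, non-adjacency and labels. -/
def Emb (G H : PGraph p) : Prop :=
  ∃ f : G.V → H.V, Function.Injective f ∧
    (∀ a b, G.adj a b ↔ H.adj (f a) (f b)) ∧ ∀ a, H.label (f a) = G.label a

end PGraph

/-- A tree model with `r` labels and height `d` for a `p`-labeled graph `G`:
a rooted tree all of whose root-to-leaf paths have length exactly `d`, whose
leaves are exactly the vertices of `G`, each leaf carrying a pair `(i, j)` with
`i ∈ Fin r` (recorded by `iLab`) and `j` the label of the vertex in `G`,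
together with a symmetric signature `S` determining adjacency from the leaf
labels and the distance in the tree. -/
structure TModel (r p d : ℕ) (G : PGraph p) where
  W : Type
  g : SimpleGraph W
  tree : g.IsTree
  root : W
  depthLe : ∀ w, g.dist root w ≤ d
  branch : ∀ w, g.dist root w < d → ∃ w', g.Adj w w' ∧ g.dist root w' = g.dist root w + 1
  leafEquiv : G.V ≃ {w : W // g.dist root w = d}
  iLab : G.V → Fin r
  S : Set (Fin r × Fin r × ℕ)
  S_range : ∀ x ∈ S, 1 ≤ x.2.2 ∧ x.2.2 ≤ d
  S_symm : ∀ i j l, (i, j, l) ∈ S ↔ (j, i, l) ∈ S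
  edge_iff : ∀ u v : G.V, u ≠ v → ∀ l : ℕ,
    g.dist (leafEquiv u).1 (leafEquiv v).1 = 2 * l →
      (G.adj u v ↔ (iLab u, iLab v, l) ∈ S)

/-- The class of all (finite or infinite) `p`-labeled graphs admitting a tree model
with `r` labels and height `d`. -/
def TM (r p d : ℕ) : Set (PGraph p) := {G | Nonempty (TModel r p d G)}

/-- The setoid of `≡^MSO_m`-equivalence on the class `TM(r,p,d)`. -/
def tmSetoid (r p d m : ℕ) : Setoid {G : PGraph p // G ∈ TM r p d} where
  r A B := MStr.MSOEquiv m A.1.toStr B.1.toStr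
  iseqv := ⟨fun _ _ _ _ => Iff.rfl, fun h φ h1 h2 => (h φ h1 h2).symm,
    fun h h' φ h1 h2 => (h φ h1 h2).trans (h' φ h1 h2)⟩

theorem SimpleGraph.IsTree.exists_parent {W : Type*} {g : SimpleGraph W} (hg : g.IsTree) (o : W) :
    ∃ par : W → W, (∀ x, g.dist x (par x) ≤ 1) ∧
      ∀ x y, g.Adj x y → g.dist o x = g.dist o y + 1 → par x = y := by
  classical
  have uniq : ∀ x y z, g.Adj x y → g.dist o x = g.dist o y + 1 → g.Adj x z →
      g.dist o x = g.dist o z + 1 → y = z := by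
    intro x y z hy hdy hz hdz
    obtain ⟨p, hp⟩ := hg.connected.exists_walk_length_eq_dist o y
    obtain ⟨q, hq⟩ := hg.connected.exists_walk_length_eq_dist o z
    have hp' : (p.concat hy.symm).IsPath :=
      SimpleGraph.Walk.isPath_of_length_eq_dist _ (by simp [hp, hdy])
    have hq' : (q.concat hz.symm).IsPath :=
      SimpleGraph.Walk.isPath_of_length_eq_dist _ (by simp [hq, hdz])
    have h := (hg.existsUnique_path o x).unique hp' hq'
    simpa using congrArg SimpleGraph.Walk.penultimate h
  refine ⟨fun x => if h : ∃ y, g.Adj x y ∧ g.dist o x = g.dist o y + 1 then h.choose else x,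
    fun x => ?_, fun x y hxy hd => ?_⟩
  · dsimp only
    split_ifs with h
    · exact (SimpleGraph.dist_eq_one_iff_adj.2 h.choose_spec.1).le
    · simp
  · have h : ∃ y, g.Adj x y ∧ g.dist o x = g.dist o y + 1 := ⟨y, hxy, hd⟩
    simp only [dif_pos h]
    exact uniq x _ y h.choose_spec.1 h.choose_spec.2 hxy hd

theorem SimpleGraph.IsTree.iterate_parent_eq_of_walk {W : Type*} {g : SimpleGraph W}
    (hg : g.IsTree) {o : W} {par : W → W}
    (hpar : ∀ x y, g.Adj x y → g.dist o x = g.dist o y + 1 → par x = y) (k : ℕ) {x y : W}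
    (p : g.Walk x y) (hp : ∀ z ∈ p.support, k ≤ g.dist o z) :
    par^[g.dist o x - k] x = par^[g.dist o y - k] y := by
  induction p with
  | nil => rfl
  | @cons x z y hxz p ih =>
    simp only [SimpleGraph.Walk.support_cons, List.mem_cons, forall_eq_or_imp] at hp
    rw [← ih hp.2]
    have hz := hp.2 z p.start_mem_support
    rcases hg.dist_eq_dist_add_one_of_adj o hxz with h | h
    · rw [show g.dist o x - k = (g.dist o z - k) + 1 by omega, Function.iterate_succ_apply,
        hpar x z hxz h]
    · rw [show g.dist o z - k = (g.dist o x - k) + 1 by omega, Function.iterate_succ_apply,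
        hpar z x hxz.symm h]

theorem SimpleGraph.IsTree.even_length_add_dist_add_dist {W : Type*} {g : SimpleGraph W}
    (hg : g.IsTree) (o : W) {x y : W} (p : g.Walk x y) :
    Even (p.length + g.dist o x + g.dist o y) := by
  induction p with
  | nil => simp
  | @cons x z y hxz p ih =>
    simp only [SimpleGraph.Walk.length_cons]
    rw [Nat.even_iff] at *
    rcases hg.dist_eq_dist_add_one_of_adj o hxz with h | h <;> omega

theorem SimpleGraph.IsTree.dist_le_two_mul_iff {W : Type*} {g : SimpleGraph W}
    (hg : g.IsTree) {o : W} {par : W → W} (hdist : ∀ x, g.dist x (par x) ≤ 1)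
    (hpar : ∀ x y, g.Adj x y → g.dist o x = g.dist o y + 1 → par x = y) {d l : ℕ} (hl : l ≤ d)
    {x y : W} (hx : g.dist o x = d) (hy : g.dist o y = d) :
    g.dist x y ≤ 2 * l ↔ par^[l] x = par^[l] y := by
  constructor
  · intro h
    obtain ⟨p, hp⟩ := hg.connected.exists_walk_length_eq_dist x y
    have key := hg.iterate_parent_eq_of_walk hpar (d - l) p fun z hz => by
      obtain ⟨q, r, rfl⟩ := SimpleGraph.Walk.mem_support_iff_exists_append.1 hz
      have h1 := SimpleGraph.dist_le q
      have h2 := SimpleGraph.dist_le r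
      have h3 := hg.connected.dist_triangle (u := o) (v := z) (w := x)
      have h4 := hg.connected.dist_triangle (u := o) (v := z) (w := y)
      rw [SimpleGraph.dist_comm] at h1
      rw [SimpleGraph.Walk.length_append] at hp
      omega
    rwa [hx, hy, show d - (d - l) = l by omega] at key
  · intro h
    have hit : ∀ n x, g.dist x (par^[n] x) ≤ n := by
      intro n
      induction n with
      | zero => simp
      | succ n ih =>
        intro x
        rw [Function.iterate_succ_apply]
        have := hg.connected.dist_triangle (u := x) (v := par x) (w := par^[n] (par x))
        have := ih (par x)
        have := hdist x
        omega
    have h1 := hit l x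
    have h2 := hit l y
    rw [h] at h1
    rw [SimpleGraph.dist_comm] at h2
    have := hg.connected.dist_triangle (u := x) (v := par^[l] y) (w := y)
    omega

/-- The half-distance of leaves in a tree model is an ultrametric. -/
theorem TModel.exists_ultrametric {r p d : ℕ} {G : PGraph p} (T : TModel r p d G) :
    ∃ δ : G.V → G.V → ℕ, (∀ x y, δ x y = 0 ↔ x = y) ∧ (∀ x y, δ x y = δ y x) ∧
      (∀ x y z, δ x z ≤ max (δ x y) (δ y z)) ∧ (∀ x y, δ x y ≤ d) ∧
      ∀ x y, x ≠ y → (G.adj x y ↔ (T.iLab x, T.iLab y, δ x y) ∈ T.S) := by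
  obtain ⟨par, hdist, hpar⟩ := T.tree.exists_parent T.root
  have hev : ∀ x y, T.g.dist (T.leafEquiv x).1 (T.leafEquiv y).1 =
      2 * (T.g.dist (T.leafEquiv x).1 (T.leafEquiv y).1 / 2) := by
    intro x y
    obtain ⟨w, hw⟩ := T.tree.connected.exists_walk_length_eq_dist
      (T.leafEquiv x).1 (T.leafEquiv y).1
    have := T.tree.even_length_add_dist_add_dist T.root w
    rw [hw, (T.leafEquiv x).2, (T.leafEquiv y).2, Nat.even_iff] at this
    omega
  have hle : ∀ x y, T.g.dist (T.leafEquiv x).1 (T.leafEquiv y).1 / 2 ≤ d := by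
    intro x y
    have h := T.tree.connected.dist_triangle (u := (T.leafEquiv x).1) (v := T.root)
      (w := (T.leafEquiv y).1)
    rw [SimpleGraph.dist_comm (v := T.root), (T.leafEquiv x).2, (T.leafEquiv y).2] at h
    omega
  refine ⟨fun x y => T.g.dist (T.leafEquiv x).1 (T.leafEquiv y).1 / 2, fun x y => ?_,
    fun x y => congrArg (· / 2) SimpleGraph.dist_comm, fun x y z => ?_, hle, fun x y hxy => ?_⟩
  · constructor
    · intro h
      have h2 := hev x y
      dsimp only at h
      rw [h, mul_zero, T.tree.connected.dist_eq_zero_iff] at h2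
      exact T.leafEquiv.injective (Subtype.ext h2)
    · rintro rfl
      simp
  · have key := fun a b => T.tree.dist_le_two_mul_iff hdist hpar
      (max_le (hle x y) (hle y z)) (T.leafEquiv a).2 (T.leafEquiv b).2
    have h1 := (key x y).1 ((hev x y).trans_le (Nat.mul_le_mul_left 2 (le_max_left _ _)))
    have h2 := (key y z).1 ((hev y z).trans_le (Nat.mul_le_mul_left 2 (le_max_right _ _)))
    have h3 := (key x z).2 (h1.trans h2)
    rw [hev x z] at h3
    exact Nat.le_of_mul_le_mul_left h3 two_pos
  · exact T.edge_iff x y hxy _ (hev x y)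

theorem TModel.nonempty {r p d : ℕ} {G : PGraph p} (T : TModel r p d G) : Nonempty G.V := by
  have h : ∀ k ≤ d, ∃ w, T.g.dist T.root w = k := by
    intro k
    induction k with
    | zero => exact fun _ => ⟨T.root, by simp⟩
    | succ k ih =>
      intro hk
      obtain ⟨w, hw⟩ := ih (by omega)
      obtain ⟨w', -, hw'⟩ := T.branch w (by omega)
      exact ⟨w', by rw [hw', hw]⟩
  obtain ⟨w, hw⟩ := h d le_rfl
  exact ⟨T.leafEquiv.symm ⟨w, hw⟩⟩

/-- Rooted trees all of whose root-to-leaf paths have length `d`. -/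
inductive TreeShape : ℕ → Type 1
  | leaf : TreeShape 0
  | node {d : ℕ} (I : Type) (child : I → TreeShape d) : TreeShape (d + 1)

namespace TreeShape

/-- The leaves of a tree. -/
def Leaf : {d : ℕ} → TreeShape d → Type
  | _, leaf => Unit
  | _, node I child => Σ i : I, (child i).Leaf

open Classical in
/-- The height of the least common ancestor of two leaves. -/
noncomputable def lca : {d : ℕ} → (s : TreeShape d) → s.Leaf → s.Leaf → ℕ
  | _, leaf => fun _ _ => 0
  | d + 1, node I child => fun (x y : Σ i : I, (child i).Leaf) =>
    if h : x.1 = y.1 then (child y.1).lca (h ▸ x.2) y.2 else d + 1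

theorem lca_node_self {d : ℕ} {I : Type} (child : I → TreeShape d) (i : I)
    (x y : (child i).Leaf) : (node I child).lca ⟨i, x⟩ ⟨i, y⟩ = (child i).lca x y := by
  simp [lca]

theorem lca_node_of_ne {d : ℕ} {I : Type} (child : I → TreeShape d) {i j : I} (h : i ≠ j)
    (x : (child i).Leaf) (y : (child j).Leaf) :
    (node I child).lca ⟨i, x⟩ ⟨j, y⟩ = d + 1 := by
  simp [lca, h]

theorem lca_eq_zero_iff {d : ℕ} (s : TreeShape d) (x y : s.Leaf) : s.lca x y = 0 ↔ x = y := by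
  induction s with
  | leaf => exact ⟨fun _ => rfl, fun _ => rfl⟩
  | node I child ih =>
    obtain ⟨i, x⟩ := x
    obtain ⟨j, y⟩ := y
    by_cases h : i = j
    · subst h
      rw [lca_node_self, ih]
      constructor
      · rintro rfl
        rfl
      · intro h
        exact eq_of_heq (Sigma.mk.inj h).2
    · rw [lca_node_of_ne _ h]
      constructor
      · omega
      · intro h'
        exact absurd (congrArg Sigma.fst h') h

/-- Every bounded natural-valued ultrametric is realised by the leaves of a tree. -/
theorem exists_of_ultrametric (d : ℕ) : ∀ (V : Type) [Nonempty V] (δ : V → V → ℕ),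
    (∀ x y, δ x y = 0 ↔ x = y) → (∀ x y, δ x y = δ y x) →
    (∀ x y z, δ x z ≤ max (δ x y) (δ y z)) → (∀ x y, δ x y ≤ d) →
    ∃ (s : TreeShape d) (f : s.Leaf ≃ V), ∀ a b, s.lca a b = δ (f a) (f b) := by
  induction d with
  | zero =>
    intro V _ δ h0 _ _ hd
    have : Subsingleton V := ⟨fun x y => (h0 x y).1 (Nat.le_zero.1 (hd x y))⟩
    have : Unique V := @Unique.mk' V (Classical.inhabited_of_nonempty ‹_›) _
    have e : Unit ≃ V := Equiv.ofUnique Unit V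
    exact ⟨leaf, e, fun a b => ((h0 (e a) (e b)).2 rfl).symm⟩
  | succ d ih =>
    intro V _ δ h0 hs hu hd
    let R : Setoid V :=
      { r := fun x y => δ x y ≤ d
        iseqv := ⟨fun x => by rw [(h0 x x).2 rfl]; exact Nat.zero_le d,
          fun {x y} h => (hs x y).symm.trans_le h, fun {x y z} h h' => (hu x y z).trans (max_le h h')⟩ }
    let mk : V → Quotient R := Quotient.mk R
    have key : ∀ i : Quotient R, ∃ (s : TreeShape d) (f : s.Leaf ≃ {x // mk x = i}),
        ∀ a b, s.lca a b = δ (f a).1 (f b).1 := by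
      intro i
      have : Nonempty {x // mk x = i} := by
        obtain ⟨x, hx⟩ := Quotient.exists_rep i
        exact ⟨⟨x, hx⟩⟩
      refine ih {x // mk x = i} (fun a b => δ a.1 b.1) (fun a b => ?_) (fun a b => hs _ _)
        (fun a b c => hu _ _ _) (fun a b => ?_)
      · rw [h0, Subtype.ext_iff]
      · exact Quotient.exact (a.2.trans b.2.symm)
    choose s f hf using key
    refine ⟨node _ s, (Equiv.sigmaCongrRight f).trans (Equiv.sigmaFiberEquiv mk), ?_⟩
    rintro ⟨i, a⟩ ⟨j, b⟩
    by_cases h : i = j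
    · subst h
      rw [lca_node_self, hf]
      rfl
    · rw [lca_node_of_ne _ h]
      refine le_antisymm ?_ (hd _ _)
      by_contra! hlt
      apply h
      have h1 : mk (f i a).1 = mk (f j b).1 := Quotient.sound (Nat.lt_succ_iff.1 hlt)
      rw [← (f i a).2, ← (f j b).2, h1]

end TreeShape
/-- The cardinality of a set, truncated at `t`. -/
noncomputable def truncCard {α : Type*} (t : ℕ) (s : Set α) : Fin (t + 1) :=
  ⟨(min s.encard t).toNat, by
    have h : (min s.encard t).toNat ≤ (t : ℕ∞).toNat :=
      ENat.toNat_le_toNat (min_le_right _ _) (ENat.natCast_ne_top t)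
    rw [ENat.toNat_natCast] at h
    omega⟩

section truncCard

variable {α β : Type u} {t : ℕ} {A : Set α} {B : Set β}

theorem truncCard_eq_iff_min :
    truncCard t A = truncCard t B ↔ min A.encard t = min B.encard t := by
  have hA : min A.encard t ≠ ⊤ := ne_top_of_le_ne_top (ENat.natCast_ne_top t) (min_le_right _ _)
  have hB : min B.encard t ≠ ⊤ := ne_top_of_le_ne_top (ENat.natCast_ne_top t) (min_le_right _ _)
  rw [truncCard, truncCard, Fin.mk.injEq]
  refine ⟨fun h => ?_, fun h => by rw [h]⟩
  rw [← ENat.natCast_toNat hA, ← ENat.natCast_toNat hB, h]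

theorem truncCard_eq_iff :
    truncCard t A = truncCard t B ↔ ∀ k ≤ t, (k : ℕ∞) ≤ A.encard ↔ (k : ℕ∞) ≤ B.encard := by
  rw [truncCard_eq_iff_min]
  constructor
  · intro h k hk
    have hk' : (k : ℕ∞) ≤ t := by exact_mod_cast hk
    have h1 : (k : ℕ∞) ≤ min A.encard t ↔ (k : ℕ∞) ≤ min B.encard t := by rw [h]
    simpa only [le_min_iff, hk', and_true] using h1
  · intro h
    have key : ∀ {γ δ : Type u} {C : Set γ} {D : Set δ},
        (∀ k ≤ t, (k : ℕ∞) ≤ C.encard → (k : ℕ∞) ≤ D.encard) →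
        min C.encard t ≤ min D.encard t := by
      intro γ δ C D h
      refine le_min ?_ (min_le_right _ _)
      have hC : min C.encard t ≠ ⊤ :=
        ne_top_of_le_ne_top (ENat.natCast_ne_top t) (min_le_right _ _)
      obtain ⟨k, hk⟩ := ENat.ne_top_iff_exists.1 hC
      rw [← hk]
      refine h k ?_ (hk.trans_le (min_le_left _ _))
      exact_mod_cast hk.trans_le (min_le_right C.encard t)
    exact le_antisymm (key fun k hk => (h k hk).1) (key fun k hk => (h k hk).2)

theorem truncCard_eq_of_encard_eq (h : A.encard = B.encard) : truncCard t A = truncCard t B :=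
  truncCard_eq_iff_min.2 (by rw [h])

/-- Truncated cardinality is determined by the truncated cardinalities of the parts of a
partition. -/
theorem truncCard_eq_of_fiberwise {σ : Type*} (f : α → σ) (g : β → σ)
    (h : ∀ i, truncCard t (A ∩ f ⁻¹' {i}) = truncCard t (B ∩ g ⁻¹' {i})) :
    truncCard t A = truncCard t B := by
  have key : ∀ {γ δ : Type u} {C : Set γ} {D : Set δ} (f : γ → σ) (g : δ → σ),
      (∀ i, ∀ k ≤ t, (k : ℕ∞) ≤ (C ∩ f ⁻¹' {i}).encard → (k : ℕ∞) ≤ (D ∩ g ⁻¹' {i}).encard) →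
      ∀ k ≤ t, (k : ℕ∞) ≤ C.encard → (k : ℕ∞) ≤ D.encard := by
    intro γ δ C D f g h k hk hC
    obtain ⟨C₀, hC₀, hcard⟩ := Set.exists_subset_encard_eq hC
    have hfin : C₀.Finite := Set.finite_of_encard_eq_coe hcard
    have hle : ∀ i, (C₀ ∩ f ⁻¹' {i}).encard ≤ (D ∩ g ⁻¹' {i}).encard := by
      intro i
      have hfi : (C₀ ∩ f ⁻¹' {i}).Finite := hfin.subset Set.inter_subset_left
      rw [← hfi.cast_ncard_eq]
      refine h i _ ?_ ?_
      · have h1 : (C₀ ∩ f ⁻¹' {i}).encard ≤ k :=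
          (Set.encard_le_encard Set.inter_subset_left).trans_eq hcard
        rw [← hfi.cast_ncard_eq] at h1
        exact (by exact_mod_cast h1 : _ ≤ k).trans hk
      · rw [hfi.cast_ncard_eq]
        exact Set.encard_le_encard (Set.inter_subset_inter_left _ hC₀)
    rcases isEmpty_or_nonempty δ with hδ | hδ
    · have : C₀ = ∅ := by
        rw [Set.eq_empty_iff_forall_notMem]
        intro x hx
        have h1 := hle (f x)
        rw [Set.eq_empty_of_isEmpty (D ∩ g ⁻¹' {f x}), Set.encard_empty, nonpos_iff_eq_zero,
          Set.encard_eq_zero] at h1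
        exact Set.eq_empty_iff_forall_notMem.1 h1 x ⟨hx, rfl⟩
      rw [← hcard, this]
      simp
    · choose e he hinj using fun i =>
        (hfin.subset (Set.inter_subset_left (t := f ⁻¹' {i}))).exists_injOn_of_encard_le (hle i)
      rw [← hcard]
      refine Set.encard_le_encard_of_injOn (f := fun x => e (f x) x) (fun x hx => ?_) ?_
      · exact (he (f x) ⟨hx, rfl⟩).1
      · intro x hx y hy hxy
        have h1 : g (e (f x) x) = f x := (he (f x) ⟨hx, rfl⟩).2
        have h2 : g (e (f y) y) = f y := (he (f y) ⟨hy, rfl⟩).2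
        have h3 : f x = f y := by
          rw [← h1, ← h2]
          exact congrArg g hxy
        dsimp only at hxy
        rw [← h3] at hxy
        exact hinj (f x) ⟨hx, rfl⟩ ⟨hy, h3.symm⟩ hxy
  simp only [truncCard_eq_iff] at h ⊢
  exact fun k hk => ⟨key f g (fun i j hj => (h i j hj).1) k hk,
    key g f (fun i j hj => (h i j hj).2) k hk⟩

theorem Set.exists_le_encard_fiber {F : Type*} [Finite F] [Nonempty F] (f : α → F)
    (h : ((t * Nat.card F : ℕ) : ℕ∞) ≤ A.encard) :
    ∃ τ, (t : ℕ∞) ≤ (A ∩ f ⁻¹' {τ}).encard := by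
  classical
  have := Fintype.ofFinite F
  by_cases hfin : A.Finite
  · obtain ⟨A, rfl⟩ := hfin.exists_finset_coe
    rw [Set.encard_coe_eq_coe_finsetCard] at h
    obtain ⟨τ, -, hτ⟩ := Finset.exists_le_card_fiber_of_mul_le_card_of_maps_to (s := A)
      (t := Finset.univ) (n := t) (f := f) (fun _ _ => Finset.mem_univ _) Finset.univ_nonempty
      (by rw [Finset.card_univ, ← Nat.card_eq_fintype_card, mul_comm]; exact_mod_cast h)
    refine ⟨τ, ?_⟩
    have heq : (A : Set α) ∩ f ⁻¹' {τ} = ({x ∈ A | f x = τ} : Finset α) := by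
      ext x
      simp
    rw [heq, Set.encard_coe_eq_coe_finsetCard]
    exact_mod_cast hτ
  · by_contra! hlt
    apply hfin
    have : A = ⋃ τ, A ∩ f ⁻¹' {τ} := by
      ext x
      simp
    rw [this]
    exact Set.finite_iUnion fun τ => Set.finite_of_encard_le_coe (hlt τ).le

/-- A colouring of `A` can be copied to `B`, preserving cardinalities of colour classes up to
the threshold `t`, if `A` and `B` have the same cardinality up to a larger threshold. -/
theorem exists_truncCard_fiber_eq {F : Type*} [Finite F] [Nonempty F] {t' : ℕ} (h0 : 1 ≤ t)
    (ht : t * Nat.card F ≤ t') (hAB : truncCard t' A = truncCard t' B) (f : α → F) :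
    ∃ g : β → F, (∀ τ, truncCard t (A ∩ f ⁻¹' {τ}) = truncCard t (B ∩ g ⁻¹' {τ})) ∧
      ∀ y ∈ B, ∃ x ∈ A, f x = g y := by
  classical
  have hAB' := truncCard_eq_iff_min.1 hAB
  by_cases hA : (t' : ℕ∞) ≤ A.encard
  · have hB : (t' : ℕ∞) ≤ B.encard := (truncCard_eq_iff.1 hAB t' le_rfl).1 hA
    have hmul : ((t * Nat.card F : ℕ) : ℕ∞) ≤ t' := by exact_mod_cast ht
    obtain ⟨τ₀, hτ₀⟩ : ∃ τ₀, (t : ℕ∞) ≤ (A ∩ f ⁻¹' {τ₀}).encard :=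
      Set.exists_le_encard_fiber f (hmul.trans hA)
    obtain ⟨x₀, hx₀, hfx₀⟩ : (A ∩ f ⁻¹' {τ₀}).Nonempty := by
      rw [← Set.one_le_encard_iff_nonempty]
      exact le_trans (by exact_mod_cast h0) hτ₀
    have hsub : ∀ τ, ∃ C ⊆ A ∩ f ⁻¹' {τ}, C.encard = min (A ∩ f ⁻¹' {τ}).encard t := fun τ =>
      Set.exists_subset_encard_eq (min_le_left _ _)
    choose C hC hCcard using hsub
    have hCfin : ∀ τ, (C τ).Finite := fun τ =>
      Set.finite_of_encard_le_coe ((hCcard τ).trans_le (min_le_right _ _))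
    have hCAt : ∀ τ, C τ = (⋃ i, C i) ∩ f ⁻¹' {τ} := by
      intro τ
      ext x
      simp only [Set.mem_inter_iff, Set.mem_iUnion, Set.mem_preimage, Set.mem_singleton_iff]
      constructor
      · exact fun hx => ⟨⟨τ, hx⟩, (hC τ hx).2⟩
      · rintro ⟨⟨i, hi⟩, hx⟩
        have h2 : f x = i := (hC i hi).2
        rwa [← hx, h2]
    have hUfin : (⋃ i, C i).Finite := Set.finite_iUnion hCfin
    have hUle : (⋃ i, C i).encard ≤ B.encard := by
      refine le_trans ?_ (hmul.trans hB)
      have := Fintype.ofFinite F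
      obtain ⟨U, hU⟩ := hUfin.exists_finset_coe
      rw [← hU, Set.encard_coe_eq_coe_finsetCard, Nat.card_eq_fintype_card, ← Finset.card_univ]
      norm_cast
      refine Finset.card_le_mul_card_image_of_maps_to (f := f) (fun _ _ => Finset.mem_univ _) t
        fun τ _ => ?_
      have h2 : ((({x ∈ U | f x = τ} : Finset α) : Set α)).encard ≤ t := by
        have : (({x ∈ U | f x = τ} : Finset α) : Set α) = C τ := by
          rw [hCAt τ, ← hU]
          ext x
          simp
        rw [this, hCcard]
        exact min_le_right _ _
      rw [Set.encard_coe_eq_coe_finsetCard] at h2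
      exact_mod_cast h2
    have : Nonempty β := by
      have h1 : 1 ≤ t' := le_trans (Nat.mul_pos h0 Nat.card_pos) ht
      have h2 : B.Nonempty := by
        rw [← Set.one_le_encard_iff_nonempty]
        exact le_trans (by exact_mod_cast h1) hB
      exact ⟨h2.some⟩
    obtain ⟨e, he, hinj⟩ := hUfin.exists_injOn_of_encard_le hUle
    let g : β → F := fun y => if h : ∃ x ∈ ⋃ i, C i, e x = y then f h.choose else τ₀
    have hg : ∀ x ∈ ⋃ i, C i, g (e x) = f x := by
      intro x hx
      have h : ∃ z ∈ ⋃ i, C i, e z = e x := ⟨x, hx, rfl⟩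
      simp only [g, dif_pos h]
      rw [hinj h.choose_spec.1 hx h.choose_spec.2]
    have hg' : ∀ y, (¬ ∃ x ∈ ⋃ i, C i, e x = y) → g y = τ₀ := fun y hy => dif_neg hy
    have himg : ∀ τ, e '' C τ ⊆ B ∩ g ⁻¹' {τ} := by
      rintro τ _ ⟨x, hx, rfl⟩
      have hxU : x ∈ ⋃ i, C i := Set.mem_iUnion.2 ⟨τ, hx⟩
      exact ⟨he hxU, (hg x hxU).trans (hC τ hx).2⟩
    have himgcard : ∀ τ, (e '' C τ).encard = min (A ∩ f ⁻¹' {τ}).encard t := fun τ => by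
      rw [← hCcard τ]
      exact (hinj.mono (Set.subset_iUnion C τ)).encard_image
    refine ⟨g, fun τ => ?_, fun y hy => ?_⟩
    · rw [truncCard_eq_iff_min]
      by_cases hτ : τ = τ₀
      · subst hτ
        rw [min_eq_right hτ₀, min_eq_right]
        have := Set.encard_le_encard (himg τ)
        rwa [himgcard, min_eq_right hτ₀] at this
      · have heq : B ∩ g ⁻¹' {τ} = e '' C τ := by
          refine (himg τ).antisymm' ?_
          rintro y ⟨hy, hgy⟩
          by_cases h : ∃ x ∈ ⋃ i, C i, e x = y
          · obtain ⟨x, hx, rfl⟩ := h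
            refine ⟨x, ?_, rfl⟩
            rw [hCAt]
            exact ⟨hx, (hg x hx).symm.trans hgy⟩
          · exact absurd ((hg' y h).symm.trans hgy).symm hτ
        rw [heq, himgcard, min_assoc, min_self]
    · by_cases h : ∃ x ∈ ⋃ i, C i, e x = y
      · obtain ⟨x, hx, rfl⟩ := h
        obtain ⟨i, hi⟩ := Set.mem_iUnion.1 hx
        exact ⟨x, (hC i hi).1, (hg x hx).symm⟩
      · exact ⟨x₀, hx₀, hfx₀.trans (hg' y h).symm⟩
  · have hB : ¬ (t' : ℕ∞) ≤ B.encard := fun h =>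
      hA ((truncCard_eq_iff.1 hAB t' le_rfl).2 h)
    rw [not_le] at hA hB
    rw [min_eq_left hA.le, min_eq_left hB.le] at hAB'
    have hAfin : A.Finite := Set.finite_of_encard_le_coe hA.le
    have hBfin : B.Finite := Set.finite_of_encard_le_coe hB.le
    rcases isEmpty_or_nonempty α with hα | hα
    · have hA0 : A = ∅ := Set.eq_empty_of_isEmpty A
      rw [hA0, Set.encard_empty, eq_comm, Set.encard_eq_zero] at hAB'
      subst hAB' hA0
      exact ⟨fun _ => Classical.arbitrary F, fun τ => truncCard_eq_of_encard_eq (by simp), by simp⟩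
    · obtain ⟨e, hbij⟩ := hBfin.exists_bijOn_of_encard_eq hAB'.symm
      refine ⟨fun y => f (e y), fun τ => truncCard_eq_of_encard_eq ?_,
        fun y hy => ⟨e y, hbij.mapsTo hy, rfl⟩⟩
      have heq : A ∩ f ⁻¹' {τ} = e '' (B ∩ (fun y => f (e y)) ⁻¹' {τ}) := by
        ext x
        constructor
        · rintro ⟨hx, hfx⟩
          obtain ⟨y, hy, rfl⟩ := hbij.surjOn hx
          exact ⟨y, ⟨hy, hfx⟩, rfl⟩
        · rintro ⟨y, ⟨hy, hfy⟩, rfl⟩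
          exact ⟨hbij.mapsTo hy, hfy⟩
      rw [heq, (hbij.injOn.mono Set.inter_subset_left).encard_image]

end truncCard
/-- A simultaneous version of `exists_truncCard_fiber_eq` for the classes of a partition. -/
theorem exists_truncCard_preimage_eq {α β : Type u} {F σ : Type*} [Finite F] [Nonempty F]
    {t t' : ℕ} (h0 : 1 ≤ t) (ht : t * Nat.card F ≤ t') (f₀ : α → σ) (g₀ : β → σ)
    (h : ∀ i, truncCard t' (f₀ ⁻¹' {i}) = truncCard t' (g₀ ⁻¹' {i})) (f : α → F) :
    ∃ g : β → F, (∀ τ, truncCard t (f ⁻¹' {τ}) = truncCard t (g ⁻¹' {τ})) ∧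
      ∀ y, ∃ x, f₀ x = g₀ y ∧ f x = g y := by
  choose g hg hg' using fun i => exists_truncCard_fiber_eq h0 ht (h i) f
  refine ⟨fun y => g (g₀ y) y, fun τ => ?_, fun y => hg' (g₀ y) y rfl⟩
  refine truncCard_eq_of_fiberwise f₀ g₀ fun i => ?_
  rw [Set.inter_comm, hg i τ]
  congr 1
  ext y
  simp only [Set.mem_inter_iff, Set.mem_preimage, Set.mem_singleton_iff]
  constructor
  · rintro ⟨rfl, h⟩
    exact ⟨h, rfl⟩
  · rintro ⟨h, rfl⟩
    exact ⟨rfl, h⟩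

namespace TreeShape

/-- Types of leaf-coloured trees with colours in `K`: the type of a tree records, for each type of
subtree, the number of children of that type, where for children of height `l` numbers are
truncated at `t l`. -/
def Ty (t : ℕ → ℕ) (K : Type) : ℕ → Type
  | 0 => K
  | d + 1 => Ty t K d → Fin (t d + 1)

instance Ty.finite (t : ℕ → ℕ) (K : Type) [Finite K] : ∀ d, Finite (Ty t K d)
  | 0 => ‹Finite K›
  | d + 1 =>
    have := Ty.finite t K d
    inferInstanceAs (Finite (Ty t K d → Fin (t d + 1)))

instance Ty.nonempty (t : ℕ → ℕ) (K : Type) [Nonempty K] : ∀ d, Nonempty (Ty t K d)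
  | 0 => ‹Nonempty K›
  | d + 1 => inferInstanceAs (Nonempty (Ty t K d → Fin (t d + 1)))

theorem Ty.card_succ (t : ℕ → ℕ) (K : Type) [Finite K] (d : ℕ) :
    Nat.card (Ty t K (d + 1)) = (t d + 1) ^ Nat.card (Ty t K d) := by
  change Nat.card (Ty t K d → Fin (t d + 1)) = _
  rw [Nat.card_fun, Nat.card_fin]

/-- The type of a leaf-coloured tree. -/
noncomputable def ty (t : ℕ → ℕ) {K : Type} :
    {d : ℕ} → (s : TreeShape d) → (s.Leaf → K) → Ty t K d
  | _, leaf => fun c => c ()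
  | d + 1, node I child => fun c τ =>
    truncCard (t d) ((fun i : I => (child i).ty t fun x => c ⟨i, x⟩) ⁻¹' {τ})

theorem ty_node {t : ℕ → ℕ} {K : Type} {d : ℕ} {I : Type} (child : I → TreeShape d)
    (c : (node I child).Leaf → K) (τ : Ty t K d) : (node I child).ty t c τ =
      truncCard (t d) ((fun i : I => (child i).ty t fun x => c ⟨i, x⟩) ⁻¹' {τ}) := rfl

/-- The back-and-forth property: an expansion by a set of leaves can be copied to any tree of
the same type, where the type of the expansions is taken with smaller thresholds. -/
theorem exists_ty_expansion_eq {t t' : ℕ → ℕ} {K : Type} [Finite K] [Nonempty K]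
    (h0 : ∀ l, 1 ≤ t l) (ht : ∀ l, t l * Nat.card (Ty t (K × Bool) l) ≤ t' l) {d : ℕ}
    (s : TreeShape d) : ∀ (s' : TreeShape d) (c : s.Leaf → K) (c' : s'.Leaf → K),
    s.ty t' c = s'.ty t' c' → ∀ e : s.Leaf → Bool, ∃ e' : s'.Leaf → Bool,
      s.ty t (fun x => (c x, e x)) = s'.ty t (fun x => (c' x, e' x)) := by
  induction s with
  | leaf =>
    rintro ⟨⟩ c c' h e
    exact ⟨e, congrArg (fun k => (k, e ())) h⟩
  | @node d I child ih =>
    intro s' c c' h e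
    cases s' with | node I' child' =>
    obtain ⟨g, hg, hg'⟩ := exists_truncCard_preimage_eq (h0 d) (ht d)
      (fun i => (child i).ty t' fun x => c ⟨i, x⟩)
      (fun i => (child' i).ty t' fun x => c' ⟨i, x⟩)
      (fun τ => congrFun h τ) (fun i => (child i).ty t fun x => (c ⟨i, x⟩, e ⟨i, x⟩))
    have key : ∀ j, ∃ e' : (child' j).Leaf → Bool,
        g j = (child' j).ty t fun x => (c' ⟨j, x⟩, e' x) := by
      intro j
      obtain ⟨i, hi, hij⟩ := hg' j
      obtain ⟨e', he'⟩ := ih i (child' j) _ _ hi fun x => e ⟨i, x⟩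
      exact ⟨e', hij.symm.trans he'⟩
    choose e' he' using key
    refine ⟨fun (x : Σ j, (child' j).Leaf) => e' x.1 x.2, ?_⟩
    funext τ
    rw [ty_node, ty_node]
    refine (hg τ).trans (congrArg (fun g => truncCard (t d) (g ⁻¹' {τ})) (funext he'))

section types

variable {t : ℕ → ℕ} {K : Type}

theorem exists_child_ty_eq (h1 : ∀ l, 1 ≤ t l) {d : ℕ} {I I' : Type} {child : I → TreeShape d}
    {child' : I' → TreeShape d} {c : (node I child).Leaf → K} {c' : (node I' child').Leaf → K}
    (h : (node I child).ty t c = (node I' child').ty t c') (i : I) :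
    ∃ j, ((child i).ty t fun x => c ⟨i, x⟩) = (child' j).ty t fun x => c' ⟨j, x⟩ := by
  have h2 := (truncCard_eq_iff.1 (congrFun h ((child i).ty t fun x => c ⟨i, x⟩)) 1 (h1 d)).1
    (by rw [Nat.cast_one, Set.one_le_encard_iff_nonempty]; exact ⟨i, rfl⟩)
  rw [Nat.cast_one, Set.one_le_encard_iff_nonempty] at h2
  obtain ⟨j, hj⟩ := h2
  exact ⟨j, hj.symm⟩

theorem exists_leaf_color_eq (h1 : ∀ l, 1 ≤ t l) {d : ℕ} (s : TreeShape d) :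
    ∀ (s' : TreeShape d) (c : s.Leaf → K) (c' : s'.Leaf → K), s.ty t c = s'.ty t c' →
      ∀ x, ∃ x', c x = c' x' := by
  induction s with
  | leaf =>
    rintro ⟨⟩ c c' h ⟨⟩
    exact ⟨(), h⟩
  | node I child ih =>
    rintro s' c c' h ⟨i, x⟩
    cases s' with | node I' child' =>
    obtain ⟨j, hj⟩ := exists_child_ty_eq h1 h i
    obtain ⟨x', hx'⟩ := ih i _ _ _ hj x
    exact ⟨⟨j, x'⟩, hx'⟩

theorem exists_leaf_pair_eq (h2 : ∀ l, 2 ≤ t l) {d : ℕ} (s : TreeShape d) :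
    ∀ (s' : TreeShape d) (c : s.Leaf → K) (c' : s'.Leaf → K), s.ty t c = s'.ty t c' →
      ∀ x y, ∃ x' y', c x = c' x' ∧ c y = c' y' ∧ s.lca x y = s'.lca x' y' := by
  have h1 : ∀ l, 1 ≤ t l := fun l => one_le_two.trans (h2 l)
  induction s with
  | leaf =>
    rintro ⟨⟩ c c' h ⟨⟩ ⟨⟩
    exact ⟨(), (), h, h, rfl⟩
  | @node d I child ih =>
    rintro s' c c' h ⟨i, x⟩ ⟨j, y⟩
    cases s' with | node I' child' =>
    by_cases hij : i = j
    · subst hij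
      obtain ⟨i', hi'⟩ := exists_child_ty_eq h1 h i
      obtain ⟨x', y', hx, hy, hxy⟩ := ih i _ _ _ hi' x y
      exact ⟨⟨i', x'⟩, ⟨i', y'⟩, hx, hy, by rw [lca_node_self, lca_node_self, hxy]⟩
    · obtain ⟨i', j', hi', hj', hij'⟩ : ∃ i' j',
          ((child i).ty t fun x => c ⟨i, x⟩) = ((child' i').ty t fun x => c' ⟨i', x⟩) ∧
          ((child j).ty t fun x => c ⟨j, x⟩) = ((child' j').ty t fun x => c' ⟨j', x⟩) ∧
          i' ≠ j' := by
        by_cases hty : ((child i).ty t fun x => c ⟨i, x⟩) = (child j).ty t fun x => c ⟨j, x⟩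
        · have h3 := (truncCard_eq_iff.1 (congrFun h ((child i).ty t fun x => c ⟨i, x⟩))
            2 (h2 d)).1 (by
              rw [Nat.cast_two, ← one_add_one_eq_two, ENat.add_one_le_iff (by simp),
                Set.one_lt_encard_iff]
              exact ⟨i, j, rfl, hty.symm, hij⟩)
          rw [Nat.cast_two, ← one_add_one_eq_two, ENat.add_one_le_iff (by simp),
            Set.one_lt_encard_iff] at h3
          obtain ⟨i', j', hi', hj', hne⟩ := h3
          exact ⟨i', j', Eq.symm hi', hty.symm.trans (Eq.symm hj'), hne⟩
        · obtain ⟨i', hi'⟩ := exists_child_ty_eq h1 h i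
          obtain ⟨j', hj'⟩ := exists_child_ty_eq h1 h j
          refine ⟨i', j', hi', hj', ?_⟩
          rintro rfl
          exact hty (hi'.trans hj'.symm)
      obtain ⟨x', hx'⟩ := exists_leaf_color_eq h1 _ _ _ _ hi' x
      obtain ⟨y', hy'⟩ := exists_leaf_color_eq h1 _ _ _ _ hj' y
      exact ⟨⟨i', x'⟩, ⟨j', y'⟩, hx', hy', by rw [lca_node_of_ne _ hij, lca_node_of_ne _ hij']⟩

end types

end TreeShape
/-- An upper bound for the number of types of trees of a given height. -/
def tyBound (M : ℕ) : ℕ → ℕ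
  | 0 => M
  | l + 1 => 2 ^ (tyBound M l ^ 3)

theorem le_tyBound (M l : ℕ) : M ≤ tyBound M l := by
  induction l with
  | zero => rfl
  | succ l ih =>
    calc M ≤ tyBound M l := ih
      _ ≤ tyBound M l ^ 3 := Nat.le_self_pow (by norm_num) _
      _ ≤ 2 ^ (tyBound M l ^ 3) := Nat.lt_two_pow_self.le

/-- The thresholds used when `q` quantifiers remain to be evaluated. -/
def tyThreshold (M q l : ℕ) : ℕ := tyBound M l ^ (q + 1)

theorem two_le_tyThreshold {M q : ℕ} (hM : q + 2 ≤ M) (l : ℕ) : 2 ≤ tyThreshold M q l :=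
  calc 2 ≤ M := by omega
    _ ≤ tyBound M l := le_tyBound M l
    _ ≤ tyBound M l ^ (q + 1) := Nat.le_self_pow (by omega) _

theorem TreeShape.Ty.card_le {M q : ℕ} (hM : q + 2 ≤ M) (K : Type) [Finite K]
    (hK : Nat.card K ≤ M) (l : ℕ) : Nat.card (Ty (tyThreshold M q) K l) ≤ tyBound M l := by
  induction l with
  | zero => exact hK
  | succ l ih =>
    rw [Ty.card_succ, tyBound]
    have hA := le_tyBound M l
    have hpos : 0 < tyBound M l := by omega
    have h1 : tyThreshold M q l + 1 ≤ 2 ^ (tyBound M l * tyBound M l) :=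
      calc tyThreshold M q l + 1 ≤ tyThreshold M q l * tyBound M l := by
            have h2 := two_le_tyThreshold hM l
            nlinarith
        _ = tyBound M l ^ (q + 2) := by rw [tyThreshold, ← pow_succ]
        _ ≤ tyBound M l ^ tyBound M l := Nat.pow_le_pow_right hpos (by omega)
        _ ≤ (2 ^ tyBound M l) ^ tyBound M l := Nat.pow_le_pow_left Nat.lt_two_pow_self.le _
        _ = 2 ^ (tyBound M l * tyBound M l) := by rw [← pow_mul]
    calc (tyThreshold M q l + 1) ^ Nat.card (Ty (tyThreshold M q) K l)
        ≤ (2 ^ (tyBound M l * tyBound M l)) ^ tyBound M l :=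
          (Nat.pow_le_pow_left h1 _).trans (Nat.pow_le_pow_right (by positivity) ih)
      _ = 2 ^ (tyBound M l ^ 3) := by rw [← pow_mul]; ring_nf

theorem tyThreshold_mul_card_le {M q : ℕ} (hM : q + 2 ≤ M) (K : Type) [Finite K]
    (hK : Nat.card K ≤ M) (l : ℕ) :
    tyThreshold M q l * Nat.card (TreeShape.Ty (tyThreshold M q) K l) ≤
      tyThreshold M (q + 1) l :=
  calc _ ≤ tyThreshold M q l * tyBound M l :=
        Nat.mul_le_mul_left _ (TreeShape.Ty.card_le hM K hK l)
    _ = _ := by rw [tyThreshold, tyThreshold, ← pow_succ]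

/-- A presentation of a structure by a tree of height `d` with leaf labels and a signature. -/
structure TreeRep {ι : Type} (A : MStr ι) (d : ℕ) (R : Type) (S : Set (R × R × ℕ)) where
  shape : TreeShape d
  equiv : A.V ≃ shape.Leaf
  lab : shape.Leaf → R × ι
  edge_iff : ∀ x y, A.E x y ↔
    x ≠ y ∧ ((lab (equiv x)).1, (lab (equiv y)).1, shape.lca (equiv x) (equiv y)) ∈ S
  pred_iff : ∀ j x, A.P j x ↔ (lab (equiv x)).2 = j

theorem TModel.nonempty_treeRep {r p d : ℕ} {G : PGraph p} (T : TModel r p d G) :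
    Nonempty (TreeRep G.toStr d (Fin r) T.S) := by
  obtain ⟨δ, h0, hs, hu, hd, hE⟩ := T.exists_ultrametric
  have := T.nonempty
  obtain ⟨s, f, hf⟩ := TreeShape.exists_of_ultrametric d G.V δ h0 hs hu hd
  have hedge : ∀ x y : G.V, G.adj x y ↔ x ≠ y ∧
      (T.iLab (f (f.symm x)), T.iLab (f (f.symm y)), s.lca (f.symm x) (f.symm y)) ∈ T.S := by
    intro x y
    rw [hf]
    simp only [Equiv.apply_symm_apply]
    by_cases hxy : x = y
    · subst hxy
      exact iff_of_false (G.irrefl _) fun h => h.1 rfl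
    · rw [hE x y hxy]
      exact ⟨fun h => ⟨hxy, h⟩, fun h => h.2⟩
  have hpred : ∀ (j : Fin p) (x : G.V), G.label x = j ↔ G.label (f (f.symm x)) = j := by simp
  exact ⟨⟨s, f.symm, fun x => (T.iLab (f x), G.label (f x)), hedge, hpred⟩⟩

/-- Structures presented by trees of the same type satisfy the same formulas; the colouring
of the trees refines the labels and defines the values of the free variables. -/
theorem MStr.Realize.of_ty_eq {ι R : Type} {d M : ℕ} {S : Set (R × R × ℕ)} (φ : MSOForm ι) :
    ∀ (q : ℕ), φ.qr ≤ q → q + 2 ≤ M → ∀ (K : Type) [Finite K], Nat.card K * 2 ^ q ≤ M →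
    ∀ (π : K → R × ι) (A B : MStr ι) (RA : TreeRep A d R S) (RB : TreeRep B d R S)
      (c : RA.shape.Leaf → K) (c' : RB.shape.Leaf → K),
      (∀ x, π (c x) = RA.lab x) → (∀ x, π (c' x) = RB.lab x) →
      RA.shape.ty (tyThreshold M q) c = RB.shape.ty (tyThreshold M q) c' →
    ∀ (v : ℕ → A.V) (v' : ℕ → B.V) (s : ℕ → Set A.V) (s' : ℕ → Set B.V),
      (∀ i ∈ φ.freeFO, ∃ P : K → Prop, (∀ a, P (c (RA.equiv a)) ↔ a = v i) ∧
        ∀ a, P (c' (RB.equiv a)) ↔ a = v' i) →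
      (∀ X ∈ φ.freeSO, ∃ P : K → Prop, (∀ a, P (c (RA.equiv a)) ↔ a ∈ s X) ∧
        ∀ a, P (c' (RB.equiv a)) ↔ a ∈ s' X) →
      A.Realize φ v s → B.Realize φ v' s' := by
  have pair : ∀ (q : ℕ), q + 2 ≤ M → ∀ (K : Type) (A B : MStr ι)
      (RA : TreeRep A d R S) (RB : TreeRep B d R S)
      (c : RA.shape.Leaf → K) (c' : RB.shape.Leaf → K),
      RA.shape.ty (tyThreshold M q) c = RB.shape.ty (tyThreshold M q) c' →
      ∀ x y x' y', (∃ P : K → Prop, (∀ a, P (c (RA.equiv a)) ↔ a = x) ∧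
        ∀ a, P (c' (RB.equiv a)) ↔ a = x') →
      (∃ P : K → Prop, (∀ a, P (c (RA.equiv a)) ↔ a = y) ∧
        ∀ a, P (c' (RB.equiv a)) ↔ a = y') →
      c (RA.equiv x) = c' (RB.equiv x') ∧ c (RA.equiv y) = c' (RB.equiv y') ∧
        RA.shape.lca (RA.equiv x) (RA.equiv y) = RB.shape.lca (RB.equiv x') (RB.equiv y') := by
    rintro q hM K A B RA RB c c' h x y x' y' ⟨P, hP, hP'⟩ ⟨Q, hQ, hQ'⟩
    obtain ⟨a, b, ha, hb, hab⟩ := TreeShape.exists_leaf_pair_eq (two_le_tyThreshold hM) _ _ _ _ h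
      (RA.equiv x) (RA.equiv y)
    obtain ⟨a, rfl⟩ := RB.equiv.surjective a
    obtain ⟨b, rfl⟩ := RB.equiv.surjective b
    obtain rfl : a = x' := by rw [← hP', ← ha, hP]
    obtain rfl : b = y' := by rw [← hQ', ← hb, hQ]
    exact ⟨ha, hb, hab⟩
  have step : ∀ (q : ℕ), q + 1 + 2 ≤ M → ∀ (K : Type) [Finite K], Nat.card K * 2 ^ (q + 1) ≤ M →
      Nonempty K → Nat.card (K × Bool) * 2 ^ q ≤ M ∧
      ∀ (A B : MStr ι) (RA : TreeRep A d R S) (RB : TreeRep B d R S)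
      (c : RA.shape.Leaf → K) (c' : RB.shape.Leaf → K),
      RA.shape.ty (tyThreshold M (q + 1)) c = RB.shape.ty (tyThreshold M (q + 1)) c' →
      ∀ e : RA.shape.Leaf → Bool, ∃ e' : RB.shape.Leaf → Bool,
        RA.shape.ty (tyThreshold M q) (fun x => (c x, e x)) =
          RB.shape.ty (tyThreshold M q) (fun x => (c' x, e' x)) := by
    intro q hM K _ hK _
    have h2 : Nat.card (K × Bool) * 2 ^ q ≤ M := by
      refine le_of_eq_of_le ?_ hK
      rw [Nat.card_prod, Nat.card_eq_fintype_card (α := Bool), Fintype.card_bool]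
      ring
    refine ⟨h2, fun A B RA RB c c' h => ?_⟩
    refine TreeShape.exists_ty_expansion_eq
      (fun l => one_le_two.trans (two_le_tyThreshold (by omega) l))
      (fun l => tyThreshold_mul_card_le (by omega) _ ?_ l) _ _ _ _ h
    exact (Nat.le_mul_of_pos_right _ (by positivity)).trans h2
  induction φ with
  | fal => exact fun _ _ _ _ _ _ _ _ _ _ _ _ _ _ _ _ _ _ _ _ _ _ h => h
  | eq i j =>
    intro q _ hM K _ _ π A B RA RB c c' _ _ hty v v' s s' hv _ h
    obtain ⟨-, -, hl⟩ := pair q hM K A B RA RB c c' hty (v i) (v j) (v' i) (v' j)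
      (hv i (by simp [MSOForm.freeFO])) (hv j (by simp [MSOForm.freeFO]))
    have h' : v i = v j := h
    rw [h', (TreeShape.lca_eq_zero_iff _ _ _).2 rfl] at hl
    exact RB.equiv.injective ((TreeShape.lca_eq_zero_iff _ _ _).1 hl.symm)
  | edge i j =>
    intro q _ hM K _ _ π A B RA RB c c' hc hc' hty v v' s s' hv _ h
    obtain ⟨hi, hj, hl⟩ := pair q hM K A B RA RB c c' hty (v i) (v j) (v' i) (v' j)
      (hv i (by simp [MSOForm.freeFO])) (hv j (by simp [MSOForm.freeFO]))
    have h' : A.E (v i) (v j) := h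
    change B.E (v' i) (v' j)
    rw [RA.edge_iff, ← hc, ← hc, hi, hj, hl, hc', hc'] at h'
    rw [RB.edge_iff]
    refine ⟨fun heq => h'.1 ?_, h'.2⟩
    rw [heq, (TreeShape.lca_eq_zero_iff _ _ _).2 rfl] at hl
    exact RA.equiv.injective ((TreeShape.lca_eq_zero_iff _ _ _).1 hl)
  | pred j i =>
    intro q _ hM K _ _ π A B RA RB c c' hc hc' hty v v' s s' hv _ h
    obtain ⟨hi, -, -⟩ := pair q hM K A B RA RB c c' hty (v i) (v i) (v' i) (v' i)
      (hv i (by simp [MSOForm.freeFO])) (hv i (by simp [MSOForm.freeFO]))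
    have h' : A.P j (v i) := h
    change B.P j (v' i)
    rwa [RA.pred_iff, ← hc, hi, hc', ← RB.pred_iff] at h'
  | mem i X =>
    intro q _ hM K _ _ π A B RA RB c c' hc hc' hty v v' s s' hv hs h
    obtain ⟨hi, -, -⟩ := pair q hM K A B RA RB c c' hty (v i) (v i) (v' i) (v' i)
      (hv i (by simp [MSOForm.freeFO])) (hv i (by simp [MSOForm.freeFO]))
    obtain ⟨P, hP, hP'⟩ := hs X (by simp [MSOForm.freeSO])
    have h' : v i ∈ s X := h
    change v' i ∈ s' X
    rwa [← hP, hi, hP'] at h'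
  | imp φ ψ ihφ ihψ =>
    intro q hq hM K _ hK π A B RA RB c c' hc hc' hty v v' s s' hv hs h hφ
    have hq' := max_le_iff.1 hq
    refine ihψ q hq'.2 hM K hK π A B RA RB c c' hc hc' hty v v' s s'
      (fun i hi => hv i (Finset.mem_union_right _ hi))
      (fun X hX => hs X (Finset.mem_union_right _ hX)) (h ?_)
    refine ihφ q hq'.1 hM K hK π B A RB RA c' c hc' hc hty.symm v' v s' s
      (fun i hi => ?_) (fun X hX => ?_) hφ
    · obtain ⟨P, h1, h2⟩ := hv i (Finset.mem_union_left _ hi)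
      exact ⟨P, h2, h1⟩
    · obtain ⟨P, h1, h2⟩ := hs X (Finset.mem_union_left _ hX)
      exact ⟨P, h2, h1⟩
  | exFO n φ ih =>
    rintro (_ | q) hq hM K _ hK π A B RA RB c c' hc hc' hty v v' s s' hv hs ⟨x, hx⟩
    · simp [MSOForm.qr] at hq
    classical
    have hq' : φ.qr ≤ q := Nat.le_of_succ_le_succ hq
    obtain ⟨hK', hstep⟩ := step q hM K hK ⟨c (RA.equiv x)⟩
    obtain ⟨e', he'⟩ := hstep A B RA RB c c' hty fun a => decide (a = RA.equiv x)
    obtain ⟨y, hy⟩ := TreeShape.exists_leaf_color_eq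
      (fun l => one_le_two.trans (two_le_tyThreshold (by omega) l)) _ _ _ _ he' (RA.equiv x)
    have hy' : e' y = true := by simpa using (congrArg Prod.snd hy).symm
    have huniq : ∀ z, e' z = true → z = y := by
      intro z hz
      obtain ⟨a, b, ha, hb, hab⟩ := TreeShape.exists_leaf_pair_eq
        (two_le_tyThreshold (by omega)) _ _ _ _ he'.symm z y
      have ha' := congrArg Prod.snd ha
      have hb' := congrArg Prod.snd hb
      simp only [hz, hy'] at ha' hb'
      rw [of_decide_eq_true ha'.symm, of_decide_eq_true hb'.symm,
        (TreeShape.lca_eq_zero_iff _ _ _).2 rfl] at hab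
      exact (TreeShape.lca_eq_zero_iff _ _ _).1 hab
    refine ⟨RB.equiv.symm y, ih q hq' (by omega) (K × Bool) hK' (fun k => π k.1) A B RA RB
      (fun a => (c a, decide (a = RA.equiv x))) (fun a => (c' a, e' a)) hc hc' he' _ _ _ _
      (fun i hi => ?_) (fun X hX => ?_) hx⟩
    · by_cases hin : i = n
      · subst hin
        refine ⟨fun k => k.2 = true, fun a => by simp, fun a => ?_⟩
        rw [Function.update_self, Equiv.eq_symm_apply]
        exact ⟨huniq _, fun h => by rw [h, hy']⟩
      · obtain ⟨P, h1, h2⟩ := hv i (Finset.mem_erase.2 ⟨hin, hi⟩)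
        refine ⟨fun k => P k.1, ?_, ?_⟩
        · simpa only [Function.update_of_ne hin] using h1
        · simpa only [Function.update_of_ne hin] using h2
    · obtain ⟨P, h1, h2⟩ := hs X hX
      exact ⟨fun k => P k.1, h1, h2⟩
  | exSO X φ ih =>
    rintro (_ | q) hq hM K _ hK π A B RA RB c c' hc hc' hty v v' s s' hv hs ⟨C, hC⟩
    · simp [MSOForm.qr] at hq
    classical
    have hq' : φ.qr ≤ q := Nat.le_of_succ_le_succ hq
    obtain ⟨hK', hstep⟩ := step q hM K hK ⟨c (RA.equiv (v 0))⟩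
    obtain ⟨e', he'⟩ := hstep A B RA RB c c' hty fun a => decide (RA.equiv.symm a ∈ C)
    refine ⟨{b | e' (RB.equiv b) = true}, ih q hq' (by omega) (K × Bool) hK' (fun k => π k.1)
      A B RA RB (fun a => (c a, decide (RA.equiv.symm a ∈ C))) (fun a => (c' a, e' a))
      hc hc' he' _ _ _ _ (fun i hi => ?_) (fun Y hY => ?_) hC⟩
    · obtain ⟨P, h1, h2⟩ := hv i hi
      exact ⟨fun k => P k.1, h1, h2⟩
    · by_cases hin : Y = X
      · subst hin
        refine ⟨fun k => k.2 = true, fun a => by simp, fun a => ?_⟩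
        rw [Function.update_self]
        rfl
      · obtain ⟨P, h1, h2⟩ := hs Y (Finset.mem_erase.2 ⟨hin, hY⟩)
        refine ⟨fun k => P k.1, ?_, ?_⟩
        · simpa only [Function.update_of_ne hin] using h1
        · simpa only [Function.update_of_ne hin] using h2

theorem TreeRep.sat_of_ty_eq {ι R : Type} [Finite R] [Finite ι] {d M m : ℕ}
    {S : Set (R × R × ℕ)} (hM : m + 2 ≤ M) (hK : Nat.card (R × ι) * 2 ^ m ≤ M)
    {A B : MStr ι} (RA : TreeRep A d R S) (RB : TreeRep B d R S)
    (h : RA.shape.ty (tyThreshold M m) RA.lab = RB.shape.ty (tyThreshold M m) RB.lab)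
    {φ : MSOForm ι} (hφ : φ.IsSentence) (hm : φ.qr ≤ m) (hA : A.Sat φ) : B.Sat φ := by
  intro v' s'
  obtain ⟨x, -⟩ := TreeShape.exists_leaf_color_eq
    (fun l => one_le_two.trans (two_le_tyThreshold hM l)) _ _ _ _ h.symm (RB.equiv (v' 0))
  refine MStr.Realize.of_ty_eq φ m hm hM (R × ι) hK id A B RA RB RA.lab RB.lab
    (fun _ => rfl) (fun _ => rfl) h (fun _ => RA.equiv.symm x) v' (fun _ => ∅) s' ?_ ?_ (hA _ _)
  · simp [hφ.1]
  · simp [hφ.2]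

theorem card_quotient_tmSetoid_le (d p r m : ℕ) {M : ℕ} (hM : m + 2 ≤ M)
    (hK : r * p * 2 ^ m ≤ M) :
    Cardinal.mk (Quotient (tmSetoid r p d m)) ≤
      ((2 ^ (r * (r * (d + 1))) * tyBound M d : ℕ) : Cardinal) := by
  have hcard : Nat.card (Fin r × Fin p) = r * p := by simp
  let sig : Set (Fin r × Fin r × Fin (d + 1)) → Set (Fin r × Fin r × ℕ) :=
    fun σ => (fun x => (x.1, x.2.1, x.2.2.val)) '' σ
  let Inv := Set (Fin r × Fin r × Fin (d + 1)) ×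
    TreeShape.Ty (tyThreshold M m) (Fin r × Fin p) d
  have hinv : ∀ G : {G : PGraph p // G ∈ TM r p d}, ∃ i : Inv,
      ∃ T : TreeRep G.1.toStr d (Fin r) (sig i.1), T.shape.ty (tyThreshold M m) T.lab = i.2 := by
    rintro ⟨G, ⟨T⟩⟩
    have hsig : sig ((fun x => (x.1, x.2.1, x.2.2.val)) ⁻¹' T.S) = T.S := by
      refine Set.image_preimage_eq_of_subset ?_
      rintro ⟨i, j, l⟩ hx
      exact ⟨(i, j, ⟨l, Nat.lt_succ_of_le (T.S_range _ hx).2⟩), rfl⟩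
    obtain ⟨D⟩ := T.nonempty_treeRep
    rw [← hsig] at D
    exact ⟨(_, D.shape.ty (tyThreshold M m) D.lab), D, rfl⟩
  choose inv hinv using hinv
  have hinj : Function.Injective fun Q : Quotient (tmSetoid r p d m) => inv Q.out := by
    intro Q Q' hQ
    obtain ⟨T, hT⟩ := hinv Q.out
    have hQ' := hinv Q'.out
    dsimp only at hQ
    rw [← hQ] at hQ'
    obtain ⟨T', hT'⟩ := hQ'
    rw [← hcard] at hK
    rw [← Quotient.out_equiv_out]
    exact fun φ hφ hm => ⟨T.sat_of_ty_eq hM hK T' (hT.trans hT'.symm) hφ hm,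
      T'.sat_of_ty_eq hM hK T (hT'.trans hT.symm) hφ hm⟩
  have hfin : Finite (Quotient (tmSetoid r p d m)) := Finite.of_injective _ hinj
  rw [← Nat.cast_card]
  norm_cast
  refine (Nat.card_le_card_of_injective _ hinj).trans ?_
  rw [Nat.card_prod]
  refine Nat.mul_le_mul (le_of_eq ?_) (TreeShape.Ty.card_le hM _ ?_ d)
  · rw [Nat.card_eq_fintype_card]
    simp
  · rw [hcard]
    exact (Nat.le_mul_of_pos_right _ (by positivity)).trans hK

theorem three_mul_tower_le (j : ℕ) {x : ℕ} (hx : 1 ≤ x) : 3 * tower j x ≤ tower j (3 * x) := by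
  induction j with
  | zero => rfl
  | succ j ih =>
    have hpos : 1 ≤ tower j x := by
      cases j with
      | zero => exact hx
      | succ j => exact Nat.one_le_two_pow
    calc 3 * 2 ^ tower j x ≤ 2 ^ 2 * 2 ^ tower j x := Nat.mul_le_mul_right _ (by norm_num)
      _ = 2 ^ (2 + tower j x) := by rw [pow_add]
      _ ≤ 2 ^ tower j (3 * x) := Nat.pow_le_pow_right two_pos (by omega)

theorem add_tower_le (j b x : ℕ) : b + tower j x ≤ tower j (b + x) := by
  induction j with
  | zero => rfl
  | succ j ih =>
    calc b + 2 ^ tower j x ≤ 2 ^ b * 2 ^ tower j x := by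
          have h1 : b + 1 ≤ 2 ^ b := Nat.lt_two_pow_self
          have h2 : 1 ≤ 2 ^ tower j x := Nat.one_le_two_pow
          nlinarith
      _ = 2 ^ (b + tower j x) := by rw [pow_add]
      _ ≤ 2 ^ tower j (b + x) := Nat.pow_le_pow_right two_pos ih

theorem tower_mono (j : ℕ) : Monotone (tower j) := by
  induction j with
  | zero => exact fun _ _ h => h
  | succ j ih => exact fun _ _ h => Nat.pow_le_pow_right two_pos (ih h)

theorem tyBound_two_pow_le {a : ℕ} (ha : 1 ≤ a) (l : ℕ) :
    tyBound (2 ^ a) l ≤ tower (l + 1) (3 ^ l * a) := by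
  induction l with
  | zero => simp [tyBound, tower]
  | succ l ih =>
    have hx : 1 ≤ 3 ^ l * a := Nat.mul_pos (by positivity) ha
    calc 2 ^ (tyBound (2 ^ a) l ^ 3) ≤ 2 ^ ((2 ^ tower l (3 ^ l * a)) ^ 3) :=
          Nat.pow_le_pow_right two_pos (Nat.pow_le_pow_left ih 3)
      _ = 2 ^ 2 ^ (3 * tower l (3 ^ l * a)) := by rw [← pow_mul, mul_comm]
      _ ≤ 2 ^ 2 ^ tower l (3 * (3 ^ l * a)) :=
          Nat.pow_le_pow_right two_pos (Nat.pow_le_pow_right two_pos (three_mul_tower_le l hx))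
      _ = tower (l + 1 + 1) (3 ^ (l + 1) * a) := by
          rw [show 3 * (3 ^ l * a) = 3 ^ (l + 1) * a by ring]
          rfl

/-- An elementary bound on the index of the `≡^MSO_m` relation over `TM(r,p,d)`. -/
theorem stmt1 (d p r : ℕ) :
    ∃ h : ℕ → ℕ, StrictMono h ∧
      ∀ m : ℕ, 1 ≤ m →
        Cardinal.mk (Quotient (tmSetoid r p d m)) ≤
          ((tower (d + 1) (h d * m ^ 2 * (1 + Nat.clog 2 r + Nat.clog 2 p) ^ 2) : ℕ) :
            Cardinal) := by
  refine ⟨fun k => k + (r * (r * (d + 1)) + 3 ^ d * (r * p + 3)),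
    fun _ _ h => Nat.add_lt_add_right h _, fun m hm => ?_⟩
  have hM : m + 2 ≤ 2 ^ (r * p + m + 2) :=
    (by omega : m + 2 ≤ r * p + m + 2).trans Nat.lt_two_pow_self.le
  have hK : r * p * 2 ^ m ≤ 2 ^ (r * p + m + 2) :=
    calc r * p * 2 ^ m ≤ 2 ^ (r * p) * 2 ^ m := Nat.mul_le_mul_right _ Nat.lt_two_pow_self.le
      _ = 2 ^ (r * p + m) := by rw [pow_add]
      _ ≤ 2 ^ (r * p + m + 2) := Nat.pow_le_pow_right two_pos (by omega)
  refine (card_quotient_tmSetoid_le d p r m hM hK).trans ?_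
  norm_cast
  set b := r * (r * (d + 1))
  have harg : b + 3 ^ d * (r * p + m + 2) ≤
      (d + (b + 3 ^ d * (r * p + 3))) * m ^ 2 * (1 + Nat.clog 2 r + Nat.clog 2 p) ^ 2 := by
    have hm2 : m ≤ m ^ 2 := Nat.le_self_pow (by norm_num) m
    have hpos : 0 < m ^ 2 := by positivity
    have h1 : r * p + m + 2 ≤ (r * p + 3) * m ^ 2 := by
      have h2 := Nat.le_mul_of_pos_right (r * p) hpos
      rw [add_mul]
      omega
    calc b + 3 ^ d * (r * p + m + 2) ≤ (b + 3 ^ d * (r * p + 3)) * m ^ 2 := by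
          rw [add_mul, mul_assoc (3 ^ d)]
          exact Nat.add_le_add (Nat.le_mul_of_pos_right _ (by positivity))
            (Nat.mul_le_mul_left _ h1)
      _ ≤ (d + (b + 3 ^ d * (r * p + 3))) * m ^ 2 := Nat.mul_le_mul_right _ (by omega)
      _ ≤ _ := Nat.le_mul_of_pos_right _ (by positivity)
  calc 2 ^ b * tyBound (2 ^ (r * p + m + 2)) d
      ≤ 2 ^ b * 2 ^ tower d (3 ^ d * (r * p + m + 2)) :=
        Nat.mul_le_mul_left _ (tyBound_two_pow_le (by omega) d)
    _ = 2 ^ (b + tower d (3 ^ d * (r * p + m + 2))) := by rw [pow_add]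
    _ ≤ tower (d + 1) (b + 3 ^ d * (r * p + m + 2)) :=
        Nat.pow_le_pow_right two_pos (add_tower_le d _ _)
    _ ≤ _ := tower_mono (d + 1) harg
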